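/- arXiv:2411.04231 — 10 statements merged into one kernel-verified Lean document; each statement's English description precedes it below -/
import Mathlib

section
/- Let g ≥ 2 be an integer, let λ₁ < λ₂ < ⋯ < λ_g be distinct real numbers, and let m₁, …, m_g be positive real numbers. Suppose that Cartan's formula with c = 0 holds, i.e., for every i ∈ {1, …, g} one has ∑_{j ≠ i} m_j · (λ_i λ_j)/(λ_i − λ_j) = 0. Then g = 2 and λ₁ λ₂ = 0 (one of the two numbers is zero). -/
/-- If Cartan's formula with `c = 0` holds and some `lam i` is positive, then all the `lam j`
but one vanish: evaluate the formula at the smallest positive `lam i`, where no summand is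
positive. -/
theorem exists_forall_ne_eq_zero_of_pos {ι : Type*} [DecidableEq ι] (s : Finset ι)
    (lam m : ι → ℝ) (hinj : Set.InjOn lam s) (hm : ∀ i ∈ s, 0 < m i)
    (hcartan : ∀ i ∈ s, ∑ j ∈ s \ {i}, m j * (lam i * lam j) / (lam i - lam j) = 0)
    (hpos : ∃ i ∈ s, 0 < lam i) :
    ∃ i ∈ s, ∀ j ∈ s, j ≠ i → lam j = 0 := by
  obtain ⟨k, hks, hk⟩ := hpos
  obtain ⟨i, hi, hmin⟩ := (s.filter (0 < lam ·)).exists_min_image lam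
    ⟨k, Finset.mem_filter.2 ⟨hks, hk⟩⟩
  obtain ⟨his, hi0⟩ := Finset.mem_filter.1 hi
  have hterm : ∀ j ∈ s \ {i}, m j * (lam i * lam j) / (lam i - lam j) ≤ 0 := by
    intro j hj
    obtain ⟨hjs, hji⟩ : j ∈ s ∧ j ≠ i := by simpa using hj
    rcases le_or_gt (lam j) 0 with h | h
    · exact div_nonpos_of_nonpos_of_nonneg
        (mul_nonpos_of_nonneg_of_nonpos (hm j hjs).le
          (mul_nonpos_of_nonneg_of_nonpos hi0.le h)) (by linarith)
    · have hle := hmin j (Finset.mem_filter.2 ⟨hjs, h⟩)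
      exact div_nonpos_of_nonneg_of_nonpos
        (mul_nonneg (hm j hjs).le (mul_nonneg hi0.le h.le)) (by linarith)
  refine ⟨i, his, fun j hjs hji => ?_⟩
  have hzero := (Finset.sum_eq_zero_iff_of_nonpos hterm).1 (hcartan i his) j (by simp [hjs, hji])
  have hne : lam i - lam j ≠ 0 := sub_ne_zero.2 fun h => hji (hinj hjs his h.symm)
  simpa [hne, (hm j hjs).ne', hi0.ne'] using hzero

/-- If Cartan's formula with `c = 0` holds and some `lam i` is nonzero, then all the `lam j`
but one vanish. -/
theorem exists_forall_ne_eq_zero_of_ne_zero {ι : Type*} [DecidableEq ι] (s : Finset ι)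
    (lam m : ι → ℝ) (hinj : Set.InjOn lam s) (hm : ∀ i ∈ s, 0 < m i)
    (hcartan : ∀ i ∈ s, ∑ j ∈ s \ {i}, m j * (lam i * lam j) / (lam i - lam j) = 0)
    (hne : ∃ i ∈ s, lam i ≠ 0) :
    ∃ i ∈ s, ∀ j ∈ s, j ≠ i → lam j = 0 := by
  obtain ⟨k, hks, hk⟩ := hne
  rcases lt_or_gt_of_ne hk with h | h
  · obtain ⟨i, his, hi⟩ := exists_forall_ne_eq_zero_of_pos s (-lam) m
      (fun a ha b hb hab => hinj ha hb (neg_injective hab)) hm (fun i his => by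
        rw [← neg_eq_zero, ← Finset.sum_neg_distrib, ← hcartan i his]
        refine Finset.sum_congr rfl fun j _ => ?_
        rw [Pi.neg_apply, Pi.neg_apply, neg_mul_neg, neg_sub_neg, ← neg_sub (lam i), div_neg,
          neg_neg])
      ⟨k, hks, by simpa using h⟩
    exact ⟨i, his, fun j hjs hji => by simpa using hi j hjs hji⟩
  · exact exists_forall_ne_eq_zero_of_pos s lam m hinj hm hcartan ⟨k, hks, h⟩

/-- Cartan's formula with `c = 0` forces `g = 2` and one of the two principal
curvatures to be zero (Euclidean case). Indices are `0`-based: `lam 0, …, lam (g-1)`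
are the distinct principal curvatures and `m 0, …, m (g-1)` their multiplicities. -/
theorem cartan_formula_euclidean (g : ℕ) (hg : 2 ≤ g) (lam m : ℕ → ℝ)
    (hmono : ∀ i j, i < j → j < g → lam i < lam j)
    (hm : ∀ i < g, 0 < m i)
    (hcartan : ∀ i < g,
      ∑ j ∈ Finset.range g \ {i}, m j * (lam i * lam j) / (lam i - lam j) = 0) :
    g = 2 ∧ lam 0 * lam 1 = 0 := by
  have h01 : lam 0 < lam 1 := hmono 0 1 one_pos hg
  have hinj : Set.InjOn lam (Finset.range g) := by
    intro a ha b hb hab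
    simp only [Finset.coe_range, Set.mem_Iio] at ha hb
    rcases lt_trichotomy a b with h | h | h
    · exact absurd hab (hmono a b h hb).ne
    · exact h
    · exact absurd hab (hmono b a h ha).ne'
  have hne : ∃ i ∈ Finset.range g, lam i ≠ 0 := by
    by_cases h : lam 0 = 0
    · exact ⟨1, Finset.mem_range.2 hg, (h ▸ h01).ne'⟩
    · exact ⟨0, Finset.mem_range.2 (by omega), h⟩
  obtain ⟨i, -, hi⟩ := exists_forall_ne_eq_zero_of_ne_zero (Finset.range g) lam m hinj
    (by simpa using hm) (by simpa using hcartan) hne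
  simp only [Finset.mem_range] at hi
  constructor
  · by_contra hg2
    have h12 : lam 1 < lam 2 := hmono 1 2 (by norm_num) (by omega)
    have h0 := hi 0 (by omega)
    have h1 := hi 1 (by omega)
    have h2 := hi 2 (by omega)
    by_cases hi0 : i = 0
    · linarith [h1 (by omega), h2 (by omega)]
    · by_cases hi1 : i = 1
      · linarith [h0 (by omega), h2 (by omega)]
      · linarith [h0 (by omega), h1 (by omega)]
  · by_cases hi0 : i = 0
    · rw [hi 1 (by omega) (by omega), mul_zero]
    · rw [hi 0 (by omega) (by omega), zero_mul]
end

section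
/- Let g ≥ 2 be an integer, let λ₁ < λ₂ < ⋯ < λ_g be distinct real numbers, and let m₁, …, m_g be positive real numbers. Suppose that Cartan's formula with c = −1 holds, i.e., for every i ∈ {1, …, g} one has ∑_{j ≠ i} m_j · (λ_i λ_j − 1)/(λ_i − λ_j) = 0. Then g = 2 and λ₁ λ₂ = 1 (the two numbers are reciprocals of each other). -/
/-- If Cartan's formula with `c = -1` holds for a finite family of distinct reals, one of which is
positive, then some member of the family is reciprocal to every other one. Such a member is a
positive one minimizing `t + t⁻¹`, for which all summands in Cartan's formula are nonpositive. -/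
theorem exists_forall_mul_eq_one_of_pos {ι : Type*} [DecidableEq ι] (s : Finset ι) (x m : ι → ℝ)
    (hx : Set.InjOn x s) (hm : ∀ i ∈ s, 0 < m i)
    (hcartan : ∀ i ∈ s, ∑ j ∈ s \ {i}, m j * (x i * x j - 1) / (x i - x j) = 0)
    (hpos : ∃ i ∈ s, 0 < x i) :
    ∃ i ∈ s, ∀ j ∈ s, j ≠ i → x i * x j = 1 := by
  obtain ⟨k, hk, hk0⟩ := hpos
  obtain ⟨i, hi, hmin⟩ := (s.filter (0 < x ·)).exists_min_image (fun i => x i + (x i)⁻¹)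
    ⟨k, Finset.mem_filter.2 ⟨hk, hk0⟩⟩
  obtain ⟨his, hi0⟩ := Finset.mem_filter.1 hi
  have hle : ∀ j ∈ s, (x i * x j - 1) * (x i - x j) ≤ 0 := by
    intro j hj
    rcases le_or_gt (x j) 0 with h | h
    · exact mul_nonpos_of_nonpos_of_nonneg
        (by linarith [mul_nonpos_of_nonneg_of_nonpos hi0.le h]) (by linarith)
    · have h1 := hmin j (Finset.mem_filter.2 ⟨hj, h⟩)
      have h2 : (x i * x j - 1) * (x i - x j)
          = x i * x j * ((x i + (x i)⁻¹) - (x j + (x j)⁻¹)) := by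
        field_simp
        ring
      rw [h2]
      exact mul_nonpos_of_nonneg_of_nonpos (by positivity) (by linarith)
  have hterm : ∀ j ∈ s \ {i}, m j * (x i * x j - 1) / (x i - x j) ≤ 0 := by
    intro j hj
    have hjs := (Finset.mem_sdiff.1 hj).1
    have h : m j * (x i * x j - 1) / (x i - x j)
        = m j * ((x i * x j - 1) * (x i - x j)) / (x i - x j) ^ 2 := by
      rcases eq_or_ne (x i - x j) 0 with h0 | h0
      · simp [h0]
      · field_simp
    rw [h]
    exact div_nonpos_of_nonpos_of_nonneg
      (mul_nonpos_of_nonneg_of_nonpos (hm j hjs).le (hle j hjs)) (sq_nonneg _)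
  refine ⟨i, his, fun j hj hji => ?_⟩
  have hzero := (Finset.sum_eq_zero_iff_of_nonpos hterm).1 (hcartan i his) j (by simp [hj, hji])
  have hne : x i - x j ≠ 0 := sub_ne_zero.2 fun h => hji (hx his hj h).symm
  simpa [hne, (hm j hj).ne', sub_eq_zero] using hzero

/-- If Cartan's formula with `c = -1` holds for a finite family of at least two distinct reals, then
some member of the family is reciprocal to every other one. -/
theorem exists_forall_mul_eq_one {ι : Type*} [DecidableEq ι] (s : Finset ι) (x m : ι → ℝ)
    (hs : s.Nontrivial) (hx : Set.InjOn x s) (hm : ∀ i ∈ s, 0 < m i)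
    (hcartan : ∀ i ∈ s, ∑ j ∈ s \ {i}, m j * (x i * x j - 1) / (x i - x j) = 0) :
    ∃ i ∈ s, ∀ j ∈ s, j ≠ i → x i * x j = 1 := by
  obtain ⟨a, ha, b, hb, hab⟩ := hs
  have hne : ∃ i ∈ s, x i ≠ 0 := by
    by_contra! h
    exact hab (hx ha hb ((h a ha).trans (h b hb).symm))
  obtain ⟨k, hk, hk0⟩ := hne
  rcases lt_or_gt_of_ne hk0 with hneg | hpos
  · have hcartan' : ∀ i ∈ s, ∑ j ∈ s \ {i}, m j * (-x i * -x j - 1) / (-x i - -x j) = 0 := by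
      intro i hi
      rw [← neg_eq_zero, ← Finset.sum_neg_distrib, ← hcartan i hi]
      refine Finset.sum_congr rfl fun j _ => ?_
      rw [neg_mul_neg, ← div_neg]
      congr 1
      ring
    simpa using exists_forall_mul_eq_one_of_pos s (fun i => -x i) m
      (fun i hi j hj h => hx hi hj (neg_injective h)) hm hcartan' ⟨k, hk, neg_pos.2 hneg⟩
  · exact exists_forall_mul_eq_one_of_pos s x m hx hm hcartan ⟨k, hk, hpos⟩


/-- Cartan's formula with `c = -1` forces `g = 2` and the two principal
curvatures to be reciprocals of each other (hyperbolic case). Indices are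
`0`-based: `lam 0, …, lam (g-1)` are the distinct principal curvatures and
`m 0, …, m (g-1)` their multiplicities. -/
theorem cartan_formula_hyperbolic (g : ℕ) (hg : 2 ≤ g) (lam m : ℕ → ℝ)
    (hmono : ∀ i j, i < j → j < g → lam i < lam j)
    (hm : ∀ i < g, 0 < m i)
    (hcartan : ∀ i < g,
      ∑ j ∈ Finset.range g \ {i}, m j * (lam i * lam j - 1) / (lam i - lam j) = 0) :
    g = 2 ∧ lam 0 * lam 1 = 1 := by
  have hinj : Set.InjOn lam (Finset.range g) := by
    refine StrictMonoOn.injOn fun i _ j hj hij => hmono i j hij ?_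
    simpa using hj
  obtain ⟨i, hi, h⟩ := exists_forall_mul_eq_one (Finset.range g) lam m
    ⟨0, by simp; omega, 1, by simp; omega, by simp⟩ hinj (by simpa using hm)
    (by simpa using hcartan)
  have huniq : ∀ j < g, ∀ k < g, j ≠ i → k ≠ i → j = k := by
    intro j hj k hk hji hki
    have hj' := h j (Finset.mem_range.2 hj) hji
    have hk' := h k (Finset.mem_range.2 hk) hki
    exact hinj (by simpa using hj) (by simpa using hk)
      (mul_left_cancel₀ (left_ne_zero_of_mul_eq_one hj') (hj'.trans hk'.symm))
  have hg2 : g = 2 := by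
    by_contra hne
    have h01 := huniq 0 (by omega) 1 (by omega)
    have h02 := huniq 0 (by omega) 2 (by omega)
    have h12 := huniq 1 (by omega) 2 (by omega)
    omega
  subst hg2
  refine ⟨rfl, ?_⟩
  have hi2 := Finset.mem_range.1 hi
  interval_cases i
  · exact h 1 (by simp) (by simp)
  · rw [mul_comm]
    exact h 0 (by simp) (by simp)
end

section
/- Let g ≥ 1 be an integer and let 0 < θ₁ < θ₂ < ⋯ < θ_g < π be real numbers such that for every i ∈ {1, …, g} one has ∑_{j ≠ i} cot(θ_j − θ_i) = 0. Then θ_i = θ₁ + (i − 1)·π/g for all i ∈ {1, …, g}; in particular the 2g focal values θ_i (mod π) are evenly spaced at intervals of length π/g. -/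
theorem Real.cot_sub_cot {a b : ℝ} (ha : Real.sin a ≠ 0) (hb : Real.sin b ≠ 0) :
    Real.cot a - Real.cot b = Real.sin (b - a) / (Real.sin a * Real.sin b) := by
  rw [Real.cot_eq_cos_div_sin, Real.cot_eq_cos_div_sin, Real.sin_sub]
  field_simp

theorem Real.cot_add_cot_eq_zero {a b : ℝ} (k : ℤ) (h : a + b = k * Real.pi) :
    Real.cot a + Real.cot b = 0 := by
  by_cases ha : Real.sin a = 0
  · have hb : Real.sin b = 0 := by
      rw [show b = k * Real.pi - a by linarith, Real.sin_sub, Real.sin_int_mul_pi, ha]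
      ring
    simp [Real.cot_eq_cos_div_sin, ha, hb]
  by_cases hb : Real.sin b = 0
  · refine absurd ?_ ha
    rw [show a = k * Real.pi - b by linarith, Real.sin_sub, Real.sin_int_mul_pi, hb]
    ring
  have hs : Real.sin (a + b) = 0 := by rw [h, Real.sin_int_mul_pi]
  rw [Real.sin_add] at hs
  rw [Real.cot_eq_cos_div_sin, Real.cot_eq_cos_div_sin]
  field_simp
  linarith

/-- The cotangent is strictly decreasing on each of `(-π, 0)` and `(0, π)`. -/
theorem Real.cot_lt_cot_of_sin_mul_sin_pos {a b : ℝ} (hab : a < b) (hπ : b - a < Real.pi)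
    (hs : 0 < Real.sin a * Real.sin b) : Real.cot b < Real.cot a := by
  have h := Real.cot_sub_cot (left_ne_zero_of_mul hs.ne') (right_ne_zero_of_mul hs.ne')
  have : 0 < Real.cot a - Real.cot b := by
    rw [h]
    exact div_pos (Real.sin_pos_of_pos_of_lt_pi (by linarith) hπ) hs
  linarith

theorem sum_cot_evenly_spaced {g i : ℕ} (hi : i < g) :
    ∑ j ∈ Finset.range g \ {i},
      Real.cot ((j : ℝ) * (Real.pi / g) - i * (Real.pi / g)) = 0 := by
  have hg : (g : ℝ) ≠ 0 := by
    have : g ≠ 0 := by omega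
    exact_mod_cast this
  have hcancel : ∀ j < g,
      Real.cot ((j : ℝ) * (Real.pi / g) - i * (Real.pi / g)) +
        Real.cot ((((2 * i + (g - j)) % g : ℕ) : ℝ) * (Real.pi / g) - i * (Real.pi / g)) = 0 := by
    intro j hj
    have hdiv := Nat.mod_add_div (2 * i + (g - j)) g
    refine Real.cot_add_cot_eq_zero (1 - ((2 * i + (g - j)) / g : ℕ)) ?_
    generalize (2 * i + (g - j)) % g = r at *
    generalize (2 * i + (g - j)) / g = q at *
    have h : (r : ℝ) + g * q + j = 2 * i + g := by
      have : r + g * q + j = 2 * i + g := by omega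
      exact_mod_cast this
    push_cast
    field_simp
    linear_combination h
  refine Finset.sum_involution (fun j _ => (2 * i + (g - j)) % g) ?_ ?_ ?_ ?_
  · intro j hj
    exact hcancel j (by simp at hj; exact hj.1)
  · intro j hj hne heq
    have h := hcancel j (by simp at hj; exact hj.1)
    rw [heq] at h
    exact hne (by linarith)
  · intro j hj
    simp only [Finset.mem_sdiff, Finset.mem_range, Finset.mem_singleton] at hj ⊢
    refine ⟨Nat.mod_lt _ (by omega), ?_⟩
    rcases lt_or_ge (2 * i + (g - j)) g with h | h
    · rw [Nat.mod_eq_of_lt h]; omega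
    rcases lt_or_ge (2 * i + (g - j)) (2 * g) with h' | h'
    · rw [Nat.mod_eq_sub_mod h, Nat.mod_eq_of_lt (by omega)]; omega
    · rw [Nat.mod_eq_sub_mod h, Nat.mod_eq_sub_mod (by omega), Nat.mod_eq_of_lt (by omega)]; omega
  · intro j hj
    simp only [Finset.mem_sdiff, Finset.mem_range, Finset.mem_singleton] at hj
    rcases lt_or_ge (2 * i + (g - j)) g with h | h
    · rw [Nat.mod_eq_of_lt h, Nat.mod_eq_of_lt (by omega)]; omega
    rcases lt_or_ge (2 * i + (g - j)) (2 * g) with h' | h'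
    · rw [Nat.mod_eq_sub_mod h, Nat.mod_eq_of_lt (by omega : 2 * i + (g - j) - g < g),
        Nat.mod_eq_sub_mod (by omega), Nat.mod_eq_of_lt (by omega)]
      omega
    · rw [Nat.mod_eq_sub_mod h, Nat.mod_eq_sub_mod (by omega : g ≤ 2 * i + (g - j) - g),
        Nat.mod_eq_of_lt (by omega : 2 * i + (g - j) - g - g < g),
        Nat.mod_eq_sub_mod (by omega), Nat.mod_eq_sub_mod (by omega), Nat.mod_eq_of_lt (by omega)]
      omega

/-- Differences of strictly increasing angles in an interval of length `π`. -/
theorem angle_sub_mem {g : ℕ} {θ : ℕ → ℝ} (hlt : θ (g - 1) - θ 0 < Real.pi)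
    (hmono : ∀ i j, i < j → j < g → θ i < θ j) {i j : ℕ} (hij : i < j) (hj : j < g) :
    0 < θ j - θ i ∧ θ j - θ i < Real.pi := by
  have h0 : θ 0 ≤ θ i := by
    rcases Nat.eq_zero_or_pos i with rfl | h
    · exact le_rfl
    · exact (hmono 0 i h (by omega)).le
  have h1 : θ j ≤ θ (g - 1) := by
    rcases Nat.lt_or_ge j (g - 1) with h | h
    · exact (hmono j (g - 1) h (by omega)).le
    · rw [show j = g - 1 by omega]
  exact ⟨sub_pos.2 (hmono i j hij hj), by linarith⟩


/-- Cartan's theorem: if `0 < θ 0 < θ 1 < ⋯ < θ (g-1) < π` and for every `i < g`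
the sum `∑_{j ≠ i} cot (θ j - θ i)` vanishes, then the angles are evenly spaced:
`θ i = θ 0 + i * (π / g)` (0-based indexing, so `i` here is `i - 1` in 1-based
notation). -/
theorem cartan_angles_evenly_spaced (g : ℕ) (hg : 1 ≤ g) (θ : ℕ → ℝ)
    (hpos : 0 < θ 0) (hlt : θ (g - 1) < Real.pi)
    (hmono : ∀ i j, i < j → j < g → θ i < θ j)
    (hsum : ∀ i < g, ∑ j ∈ Finset.range g \ {i}, Real.cot (θ j - θ i) = 0) :
    ∀ i < g, θ i = θ 0 + i * (Real.pi / g) := by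
  have hg0 : (0 : ℝ) < g := by exact_mod_cast hg
  have hstep : 0 < Real.pi / g := div_pos Real.pi_pos hg0
  set φ : ℕ → ℝ := fun i => i * (Real.pi / g) with hφ
  have hφmono : ∀ i j, i < j → j < g → φ i < φ j := fun i j hij _ =>
    mul_lt_mul_of_pos_right (by exact_mod_cast hij) hstep
  have hφlt : φ (g - 1) - φ 0 < Real.pi := by
    have h : φ (g - 1) = Real.pi - Real.pi / g := by
      simp only [hφ]
      push_cast [hg]
      field_simp
    have h0 : φ 0 = 0 := by simp [hφ]
    linarith
  have hθlt : θ (g - 1) - θ 0 < Real.pi := by linarith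
  obtain ⟨i, hi, hmax⟩ := Finset.exists_max_image (Finset.range g) (fun j => θ j - φ j)
    ⟨0, Finset.mem_range.2 hg⟩
  rw [Finset.mem_range] at hi
  have hcot : ∀ j ∈ Finset.range g \ {i}, θ j - θ i < φ j - φ i →
      Real.cot (φ j - φ i) < Real.cot (θ j - θ i) := by
    intro j hj hlt'
    simp only [Finset.mem_sdiff, Finset.mem_range, Finset.mem_singleton] at hj
    rcases lt_or_gt_of_ne hj.2 with hji | hij
    · obtain ⟨h1, h2⟩ := angle_sub_mem hθlt hmono hji hi
      obtain ⟨h3, h4⟩ := angle_sub_mem hφlt hφmono hji hi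
      exact Real.cot_lt_cot_of_sin_mul_sin_pos hlt' (by linarith) (mul_pos_of_neg_of_neg
        (Real.sin_neg_of_neg_of_neg_pi_lt (by linarith) (by linarith))
        (Real.sin_neg_of_neg_of_neg_pi_lt (by linarith) (by linarith)))
    · obtain ⟨h1, h2⟩ := angle_sub_mem hθlt hmono hij hj.1
      obtain ⟨h3, h4⟩ := angle_sub_mem hφlt hφmono hij hj.1
      exact Real.cot_lt_cot_of_sin_mul_sin_pos hlt' (by linarith) (mul_pos
        (Real.sin_pos_of_pos_of_lt_pi h1 h2) (Real.sin_pos_of_pos_of_lt_pi h3 h4))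
  have hle : ∀ j < g, θ j - θ i ≤ φ j - φ i := fun j hj => by
    linarith [hmax j (Finset.mem_range.2 hj)]
  have hcot_le : ∀ j ∈ Finset.range g \ {i}, Real.cot (φ j - φ i) ≤ Real.cot (θ j - θ i) := by
    intro j hj
    rcases (hle j (Finset.mem_range.1 (Finset.mem_sdiff.1 hj).1)).lt_or_eq with h | h
    · exact (hcot j hj h).le
    · rw [h]
  have hcot_eq := (Finset.sum_eq_sum_iff_of_le hcot_le).1
    ((sum_cot_evenly_spaced hi).trans (hsum i hi).symm)
  have heq : ∀ j < g, θ j - θ i = φ j - φ i := by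
    intro j hj
    by_cases hji : j = i
    · simp [hji]
    have hmem : j ∈ Finset.range g \ {i} := by simp [hj, hji]
    exact (hle j hj).eq_of_not_lt fun h => (hcot j hmem h).ne (hcot_eq j hmem)
  intro j hj
  have h0 : φ 0 = 0 := by simp [hφ]
  change θ j = θ 0 + φ j
  linarith [heq j hj, heq 0 hg]
end

section
/- Let g ≥ 2 be an integer, let 0 < θ₁ < θ₂ < ⋯ < θ_g < π be real numbers, and let m₁, …, m_g be positive integers. Suppose that for every i ∈ {1, …, g} and every real number c, the sum of m_j over all j ≠ i with cot(θ_j − θ_i) = c equals the sum of m_j over all j ≠ i with cot(θ_j − θ_i) = −c (i.e., for each i the multiset of values cot(θ_j − θ_i), j ≠ i, counted with multiplicities m_j, is invariant under negation). Then θ_i = θ₁ + (i − 1)·π/g for all i, and m_{i+2} = m_i for all i, where indices are taken cyclically modulo g (so m_{g+1} = m₁ and m_{g+2} = m₂). -/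
open scoped Classical

/-- Two angles with opposite cotangents sum to an integer multiple of `π`. -/
lemma exists_int_mul_pi_eq_add_of_cot_eq_neg_cot {x y : ℝ} (hx : Real.sin x ≠ 0)
    (hy : Real.sin y ≠ 0) (h : Real.cot x = -Real.cot y) : ∃ z : ℤ, z * Real.pi = x + y := by
  rw [← Real.sin_eq_zero_iff, Real.sin_add]
  rw [Real.cot_eq_cos_div_sin, Real.cot_eq_cos_div_sin] at h
  field_simp at h
  linarith

/-- Two angles with equal cotangents differ by an integer multiple of `π`. -/
lemma exists_int_mul_pi_eq_sub_of_cot_eq_cot {x y : ℝ} (hx : Real.sin x ≠ 0)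
    (hy : Real.sin y ≠ 0) (h : Real.cot x = Real.cot y) : ∃ z : ℤ, z * Real.pi = x - y := by
  rw [sub_eq_add_neg]
  refine exists_int_mul_pi_eq_add_of_cot_eq_neg_cot hx (by simpa using hy) ?_
  simp [h, Real.cot_eq_cos_div_sin, div_neg]

/-- If the range of a strictly monotone sequence is invariant under reflection about each of its
points, and the reflections preserve `M`, then the sequence is an arithmetic progression and `M`
is `2`-periodic. -/
lemma arithmetic_progression_of_reflection {α : Type*} {T : ℤ → ℝ} {M : ℤ → α}
    (hT : StrictMono T) (hrefl : ∀ n k, ∃ l, T l = 2 * T n - T k ∧ M l = M k) :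
    (∀ n : ℕ, T n = T 0 + n * (T 1 - T 0)) ∧ ∀ n, M (n + 2) = M n := by
  have key : ∀ n, T (n + 2) = 2 * T (n + 1) - T n ∧ M (n + 2) = M n := by
    intro n
    obtain ⟨l, hl, -⟩ := hrefl (n + 1) (n + 2)
    obtain ⟨k, hk, hMk⟩ := hrefl (n + 1) n
    have h₁ : T n < T (n + 1) := hT (by lia)
    have h₂ : T (n + 1) < T (n + 2) := hT (by lia)
    have hl' : l < n + 1 := hT.lt_iff_lt.1 (by linarith)
    have hk' : n + 1 < k := hT.lt_iff_lt.1 (by linarith)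
    have hl'' : T l ≤ T n := hT.monotone (by lia)
    have hk'' : T (n + 2) ≤ T k := hT.monotone (by lia)
    have h : T (n + 2) = T k := by linarith
    exact ⟨h.trans hk, by rw [hT.injective h, hMk]⟩
  refine ⟨fun n => ?_, fun n => (key n).2⟩
  induction n using Nat.twoStepInduction with
  | zero => simp
  | one => simp
  | more n h₀ h₁ =>
    have h := (key n).1
    push_cast at h₁ ⊢
    rw [h, h₀, h₁]
    ring

/-- The extension of `θ 0, …, θ (g - 1)` to a sequence on `ℤ` that grows by `π` over every `g`
consecutive steps. -/
noncomputable def quasiperiodicExtension (g : ℕ) (θ : ℕ → ℝ) (n : ℤ) : ℝ :=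
  θ (n % g).toNat + (n / g : ℤ) * Real.pi

lemma toNat_add_mul_emod {g r : ℕ} (hr : r < g) (q : ℤ) : ((r + g * q : ℤ) % g).toNat = r := by
  rw [Int.add_mul_emod_self_left, Int.emod_eq_of_lt (by lia) (by lia), Int.toNat_natCast]

lemma quasiperiodicExtension_add_mul {g r : ℕ} (θ : ℕ → ℝ) (hr : r < g) (q : ℤ) :
    quasiperiodicExtension g θ (r + g * q) = θ r + q * Real.pi := by
  rw [quasiperiodicExtension, toNat_add_mul_emod hr, Int.add_mul_ediv_left _ _ (by lia),
    Int.ediv_eq_zero_of_lt (by lia) (by lia), zero_add]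

lemma exists_eq_add_mul {g : ℕ} (hg : 0 < g) (n : ℤ) : ∃ r < g, ∃ q : ℤ, n = r + g * q := by
  have h := Int.emod_nonneg n (b := g) (by lia)
  have h' := Int.emod_lt_of_pos n (b := g) (by lia)
  refine ⟨(n % g).toNat, by lia, n / g, ?_⟩
  rw [Int.toNat_of_nonneg h, Int.emod_add_mul_ediv]

lemma strictMono_quasiperiodicExtension {g : ℕ} {θ : ℕ → ℝ} (hg : 0 < g)
    (hmono : ∀ i j, i < j → j < g → θ i < θ j) (hlt : θ (g - 1) < θ 0 + Real.pi) :
    StrictMono (quasiperiodicExtension g θ) := by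
  refine strictMono_int_of_lt_succ fun n => ?_
  obtain ⟨r, hr, q, rfl⟩ := exists_eq_add_mul hg n
  rw [quasiperiodicExtension_add_mul θ hr]
  by_cases h : r + 1 < g
  · have e : (r + g * q + 1 : ℤ) = (r + 1 : ℕ) + g * q := by push_cast; ring
    rw [e, quasiperiodicExtension_add_mul θ h]
    linarith [hmono r (r + 1) (by lia) h]
  · obtain rfl : g = r + 1 := by lia
    have e : (r + (r + 1 : ℕ) * q + 1 : ℤ) = (0 : ℕ) + (r + 1 : ℕ) * (q + 1) := by
      push_cast; ring
    rw [e, quasiperiodicExtension_add_mul θ hg]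
    push_cast
    simp only [add_tsub_cancel_right] at hlt
    linarith

/-- Münzner's theorem (algebraic core): if `0 < θ 0 < ⋯ < θ (g-1) < π` with
positive integer multiplicities `m 0, …, m (g-1)`, and for every `i < g` the
multiset of values `cot (θ j - θ i)`, `j ≠ i`, counted with multiplicities
`m j`, is invariant under negation, then the angles are evenly spaced at
intervals `π / g` and the multiplicities satisfy `m (i+2) = m i` with indices
taken cyclically modulo `g` (0-based indexing). -/
theorem muenzner_angles_and_multiplicities (g : ℕ) (hg : 2 ≤ g) (θ : ℕ → ℝ)
    (m : ℕ → ℕ)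
    (hpos : 0 < θ 0) (hlt : θ (g - 1) < Real.pi)
    (hmono : ∀ i j, i < j → j < g → θ i < θ j)
    (hm : ∀ i < g, 0 < m i)
    (hsym : ∀ i < g, ∀ c : ℝ,
      ∑ j ∈ (Finset.range g \ {i}).filter (fun j => Real.cot (θ j - θ i) = c), m j
        = ∑ j ∈ (Finset.range g \ {i}).filter (fun j => Real.cot (θ j - θ i) = -c), m j) :
    (∀ i < g, θ i = θ 0 + i * (Real.pi / g)) ∧ (∀ i < g, m ((i + 2) % g) = m i) := by
  have hg₀ : 0 < g := by lia
  set T := quasiperiodicExtension g θ with hTdef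
  set M : ℤ → ℕ := fun n => m (n % g).toNat with hMdef
  have hTr : ∀ {r}, r < g → ∀ q : ℤ, T (r + g * q) = θ r + q * Real.pi :=
    quasiperiodicExtension_add_mul θ
  have hMr : ∀ {r}, r < g → ∀ q : ℤ, M (r + g * q) = m r := fun hr q => by
    simp only [hMdef, toNat_add_mul_emod hr]
  have hT : StrictMono T := strictMono_quasiperiodicExtension hg₀ hmono (by linarith)
  have hθ : ∀ {i j}, i < g → j < g → ∀ z : ℤ, z * Real.pi = θ j - θ i → j = i := by
    intro i j hi hj z hz
    have h := hT.injective (show T (j + g * 0) = T (i + g * z) by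
      rw [hTr hi, hTr hj]; push_cast; linarith)
    simpa only [toNat_add_mul_emod hi, toNat_add_mul_emod hj] using
      congrArg (fun n : ℤ => (n % g).toNat) h
  have hsin : ∀ {i j}, i < g → j < g → j ≠ i → Real.sin (θ j - θ i) ≠ 0 := by
    intro i j hi hj hji h
    obtain ⟨z, hz⟩ := Real.sin_eq_zero_iff.1 h
    exact hji (hθ hi hj z hz)
  have hsum : ∀ {i j}, i < g → j < g → j ≠ i → ∀ c, Real.cot (θ j - θ i) = c →
      ∑ k ∈ (Finset.range g \ {i}).filter (fun k => Real.cot (θ k - θ i) = c), m k = m j := by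
    rintro i j hi hj hji c rfl
    rw [Finset.sum_eq_single_of_mem j (by simp [hj, hji])]
    intro k hk hkj
    simp only [Finset.mem_filter, Finset.mem_sdiff, Finset.mem_range,
      Finset.mem_singleton] at hk
    obtain ⟨⟨hk, hki⟩, hc⟩ := hk
    obtain ⟨z, hz⟩ :=
      exists_int_mul_pi_eq_sub_of_cot_eq_cot (hsin hi hk hki) (hsin hi hj hji) hc
    exact absurd (hθ hj hk z (by linarith)) hkj
  have hrefl : ∀ n k, ∃ l, T l = 2 * T n - T k ∧ M l = M k := by
    intro n k
    obtain ⟨i, hi, p, rfl⟩ := exists_eq_add_mul hg₀ n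
    obtain ⟨j, hj, q, rfl⟩ := exists_eq_add_mul hg₀ k
    rw [hTr hi, hTr hj, hMr hj]
    by_cases hji : j = i
    · subst hji
      refine ⟨j + g * (2 * p - q), ?_, hMr hj _⟩
      rw [hTr hj]
      push_cast
      ring
    · have h := hsym i hi (Real.cot (θ j - θ i))
      rw [hsum hi hj hji _ rfl] at h
      obtain ⟨l, hl, -⟩ := Finset.exists_ne_zero_of_sum_ne_zero (h ▸ (hm j hj).ne')
      simp only [Finset.mem_filter, Finset.mem_sdiff, Finset.mem_range,
        Finset.mem_singleton] at hl
      obtain ⟨⟨hl, hli⟩, hc⟩ := hl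
      rw [hsum hi hl hli _ hc] at h
      obtain ⟨z, hz⟩ :=
        exists_int_mul_pi_eq_add_of_cot_eq_neg_cot (hsin hi hl hli) (hsin hi hj hji) hc
      refine ⟨l + g * (2 * p - q - z), ?_, (hMr hl _).trans h.symm⟩
      rw [hTr hl]
      push_cast
      linarith
  obtain ⟨hAP, hper⟩ := arithmetic_progression_of_reflection hT hrefl
  have hT_nat : ∀ i < g, T i = θ i := fun i hi => by simpa using hTr hi 0
  have hT_zero : T 0 = θ 0 := by simpa using hT_nat 0 hg₀
  have hstep : T 1 - T 0 = Real.pi / g := by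
    have h := hTr hg₀ 1
    simp only [Nat.cast_zero, zero_add, mul_one, Int.cast_one, one_mul] at h
    rw [hAP g, hT_zero] at h
    rw [eq_div_iff (by positivity), hT_zero]
    linarith
  refine ⟨fun i hi => ?_, fun i hi => ?_⟩
  · rw [← hT_nat i hi, hAP i, hstep, hT_zero]
  · have h := hper i
    have e : ((i : ℤ) + 2) % g = ((i + 2) % g : ℕ) := by push_cast; rfl
    simpa only [hMdef, e, Int.toNat_natCast, ← Int.natCast_emod, Nat.mod_eq_of_lt hi] using h
end

section
/- Let U be an open subset of EuclideanSpace ℝ n, let F : EuclideanSpace ℝ n → ℝ be twice continuously differentiable on U with gradient ∇F nonvanishing on U, and suppose there is a differentiable function φ : ℝ → ℝ such that ‖∇F(x)‖² = φ(F(x)) for all x ∈ U. Define the unit vector field ξ(x) = ‖∇F(x)‖⁻¹ • ∇F(x) on U. Then for every x ∈ U, the Fréchet derivative of ξ at x evaluated in the direction ξ(x) vanishes: (fderiv ℝ ξ x)(ξ x) = 0. (Hence the integral curves of ξ are straight lines, i.e., geodesics of Euclidean space.) -/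
/-- The gradient of a `C²` function is differentiable. -/
theorem ContDiffAt.differentiableAt_gradient {E : Type*} [NormedAddCommGroup E]
    [InnerProductSpace ℝ E] [CompleteSpace E] {F : E → ℝ} {x : E} (hF : ContDiffAt ℝ 2 F x) :
    DifferentiableAt ℝ (gradient F) x :=
  (InnerProductSpace.toDual ℝ E).symm.toContinuousLinearEquiv.differentiableAt.comp x
    ((hF.fderiv_right (m := 1) (by norm_num)).differentiableAt (by norm_num))

/-- The Hessian of a `C²` function, as the derivative of its gradient, is self-adjoint. -/
theorem ContDiffAt.inner_fderiv_gradient_comm {E : Type*} [NormedAddCommGroup E]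
    [InnerProductSpace ℝ E] [CompleteSpace E] {F : E → ℝ} {x : E} (hF : ContDiffAt ℝ 2 F x)
    (v w : E) :
    Inner.inner ℝ (fderiv ℝ (gradient F) x v) w = Inner.inner ℝ (fderiv ℝ (gradient F) x w) v := by
  have key (v w : E) :
      Inner.inner ℝ (fderiv ℝ (gradient F) x v) w = fderiv ℝ (fderiv ℝ F) x v w := by
    have h : fderiv ℝ F = (InnerProductSpace.toDual ℝ E) ∘ gradient F :=
      toDual_comp_gradient.symm
    have hd := ((InnerProductSpace.toDual ℝ E).toContinuousLinearEquiv.hasFDerivAt.comp x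
      hF.differentiableAt_gradient.hasFDerivAt).fderiv
    rw [h]
    erw [hd]
    simp
  rw [key, key]
  exact hF.isSymmSndFDerivAt (by simp) v w

open Topology in
/-- If `‖∇F‖²` is a function of `F` near `x`, then `∇F x` is an eigenvector of the Hessian. -/
theorem ContDiffAt.fderiv_gradient_apply_gradient {E : Type*} [NormedAddCommGroup E]
    [InnerProductSpace ℝ E] [CompleteSpace E] {F : E → ℝ} {x : E} (hF : ContDiffAt ℝ 2 F x)
    {φ : ℝ → ℝ} (hφ : DifferentiableAt ℝ φ (F x))
    (h : ∀ᶠ y in 𝓝 x, ‖gradient F y‖ ^ 2 = φ (F y)) :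
    fderiv ℝ (gradient F) x (gradient F x) = (deriv φ (F x) / 2) • gradient F x := by
  refine ext_inner_right ℝ fun v ↦ ?_
  have hFd : DifferentiableAt ℝ F x := hF.differentiableAt (by norm_num)
  have hl := hF.differentiableAt_gradient.hasFDerivAt.norm_sq
  have hr := hφ.hasDerivAt.comp_hasFDerivAt x hFd.hasFDerivAt
  have hv := DFunLike.congr_fun (hl.unique (hr.congr_of_eventuallyEq h)) v
  simp only [smul_apply, ContinuousLinearMap.comp_apply, innerSL_apply_apply, nsmul_eq_mul,
    Nat.cast_ofNat, smul_eq_mul, ← inner_gradient_left] at hv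
  rw [hF.inner_fderiv_gradient_comm, real_inner_smul_left, real_inner_comm]
  linarith


/-- Cartan's theorem (Euclidean case): if `F` is `C²` on an open set `U` with
nonvanishing gradient, and `‖∇F‖²` is a (differentiable) function of `F` on `U`,
then the normalized gradient field `ξ = ∇F / ‖∇F‖` satisfies
`(fderiv ℝ ξ x) (ξ x) = 0` on `U`; hence its integral curves are straight
lines, i.e. geodesics of Euclidean space. -/
theorem integral_curves_of_normalized_gradient_are_geodesics
    (n : ℕ) (U : Set (EuclideanSpace ℝ (Fin n))) (hU : IsOpen U)
    (F : EuclideanSpace ℝ (Fin n) → ℝ) (hF : ContDiffOn ℝ 2 F U)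
    (hgrad : ∀ x ∈ U, gradient F x ≠ 0)
    (φ : ℝ → ℝ) (hφ : Differentiable ℝ φ)
    (hiso : ∀ x ∈ U, ‖gradient F x‖ ^ 2 = φ (F x))
    (ξ : EuclideanSpace ℝ (Fin n) → EuclideanSpace ℝ (Fin n))
    (hξ : ∀ x, ξ x = ‖gradient F x‖⁻¹ • gradient F x) :
    ∀ x ∈ U, fderiv ℝ ξ x (ξ x) = 0 := by
  intro x hx
  have hUx := hU.mem_nhds hx
  have hFx : ContDiffAt ℝ 2 F x := hF.contDiffAt hUx
  have hG := hFx.differentiableAt_gradient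
  have hG0 := hgrad x hx
  have hH := hFx.fderiv_gradient_apply_gradient (hφ _) (Filter.eventually_of_mem hUx hiso)
  obtain rfl : ξ = fun y ↦ ‖gradient F y‖⁻¹ • gradient F y := funext hξ
  have hr : DifferentiableAt ℝ (fun y ↦ ‖gradient F y‖⁻¹) x :=
    (hG.norm ℝ hG0).inv (norm_ne_zero_iff.mpr hG0)
  have hd := hr.hasFDerivAt.smul hG.hasFDerivAt
  obtain ⟨a, ha⟩ : ∃ a : ℝ, fderiv ℝ (fun y ↦ ‖gradient F y‖⁻¹ • gradient F y) x
      (‖gradient F x‖⁻¹ • gradient F x) = a • gradient F x := by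
    refine ⟨‖gradient F x‖⁻¹ * (‖gradient F x‖⁻¹ * (deriv φ (F x) / 2)) +
      fderiv ℝ (fun y ↦ ‖gradient F y‖⁻¹) x (‖gradient F x‖⁻¹ • gradient F x), ?_⟩
    rw [HasFDerivAt.fderiv (f := fun y ↦ ‖gradient F y‖⁻¹ • gradient F y) hd]
    simp only [add_apply, smul_apply,
      ContinuousLinearMap.smulRight_apply, map_smul, hH]
    module
  have hone : (fun y ↦ ‖‖gradient F y‖⁻¹ • gradient F y‖ ^ 2) =ᶠ[nhds x] fun _ ↦ (1 : ℝ) :=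
    Filter.eventually_of_mem hUx fun y hy ↦ by
      have := norm_ne_zero_iff.mpr (hgrad y hy)
      simp [norm_smul, this]
  have hn := (hr.smul hG).hasFDerivAt.norm_sq.unique
    ((hasFDerivAt_const (1 : ℝ) x).congr_of_eventuallyEq hone)
  have hv := DFunLike.congr_fun hn (‖gradient F x‖⁻¹ • gradient F x)
  have ha' : inner ℝ (‖gradient F x‖⁻¹ • gradient F x) (a • gradient F x) = 0 := by
    rw [← ha]
    simp only [smul_apply, ContinuousLinearMap.comp_apply, innerSL_apply_apply, nsmul_eq_mul,
      Nat.cast_ofNat, zero_apply, mul_eq_zero, OfNat.ofNat_ne_zero, false_or] at hv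
    exact hv
  have : a = 0 := by
    simpa [real_inner_smul_left, real_inner_smul_right, hG0, -inner_gradient_left,
      -inner_gradient_right] using ha'
  simpa [this] using ha
end

section
/- Let E be a real inner product space, let g be a natural number, and let F : E → ℝ be differentiable and homogeneous of degree g, i.e., F(t • x) = t^g · F(x) for all t ∈ ℝ and x ∈ E. Then for every x ∈ E with ‖x‖ = 1, one has ‖∇F(x) − ⟪∇F(x), x⟫ • x‖² = ‖∇F(x)‖² − g²·F(x)². -/
open scoped RealInnerProductSpace

/-- Euler's relation at a single point: `F` need only be homogeneous along the line through `x`. -/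
theorem fderiv_apply_self_of_homogeneous
    {E : Type*} [NormedAddCommGroup E] [NormedSpace ℝ E] {g : ℕ} {F : E → ℝ} {x : E}
    (hF : DifferentiableAt ℝ F x) (hhom : ∀ t : ℝ, F (t • x) = t ^ g * F x) :
    fderiv ℝ F x x = g * F x := by
  have hline : HasDerivAt (fun t : ℝ => t • x) x 1 := by
    simpa using (hasDerivAt_id (1 : ℝ)).smul_const x
  have hcomp : HasDerivAt (fun t : ℝ => F (t • x)) (fderiv ℝ F x x) 1 :=
    HasFDerivAt.comp_hasDerivAt (1 : ℝ) (by simpa using hF.hasFDerivAt) hline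
  have hpow : HasDerivAt (fun t : ℝ => F (t • x)) (g * F x) 1 := by
    simpa [hhom] using (hasDerivAt_pow g (1 : ℝ)).mul_const (F x)
  exact hcomp.unique hpow

/-- Pythagoras for the projection onto the orthogonal complement of a unit vector. -/
theorem norm_sub_inner_smul_sq
    {E : Type*} [NormedAddCommGroup E] [InnerProductSpace ℝ E] (v : E) {x : E} (hx : ‖x‖ = 1) :
    ‖v - ⟪v, x⟫ • x‖ ^ 2 = ‖v‖ ^ 2 - ⟪v, x⟫ ^ 2 := by
  rw [norm_sub_sq_real, real_inner_smul_right, norm_smul, hx, mul_one, Real.norm_eq_abs, sq_abs]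
  ring

/-- For a differentiable function `F` on a real inner product space that is
homogeneous of degree `g`, the squared norm of the spherical gradient at a
unit vector `x` (the tangential projection of the gradient) equals
`‖∇F(x)‖² − g²·F(x)²`. -/
theorem spherical_gradient_of_homogeneous
    {E : Type*} [NormedAddCommGroup E] [InnerProductSpace ℝ E] [CompleteSpace E]
    (g : ℕ) (F : E → ℝ) (hF : Differentiable ℝ F)
    (hhom : ∀ (t : ℝ) (x : E), F (t • x) = t ^ g * F x) :
    ∀ x : E, ‖x‖ = 1 →
      ‖gradient F x - ⟪gradient F x, x⟫ • x‖ ^ 2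
        = ‖gradient F x‖ ^ 2 - (g : ℝ) ^ 2 * (F x) ^ 2 := by
  intro x hx
  rw [norm_sub_inner_smul_sq _ hx, inner_gradient_left,
    fderiv_apply_self_of_homogeneous (hF x) fun t => hhom t x, mul_pow]
end

section
/- Let E be a real inner product space, let g be a natural number, and let F : E → ℝ be differentiable, homogeneous of degree g (F(t • x) = t^g · F(x) for all t ∈ ℝ, x ∈ E), and satisfy the first Cartan–Münzner differential equation ‖∇F(x)‖² = g²·‖x‖^{2g−2} for all x ∈ E. Then for every x ∈ E with ‖x‖ = 1, one has ‖∇F(x) − ⟪∇F(x), x⟫ • x‖² = g²·(1 − F(x)²). -/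
open scoped RealInnerProductSpace

/-- **Euler's identity** for a differentiable function homogeneous of degree `g`. -/
theorem inner_gradient_self_of_homogeneous
    {E : Type*} [NormedAddCommGroup E] [InnerProductSpace ℝ E] [CompleteSpace E]
    {g : ℕ} {F : E → ℝ} {x : E} (hF : DifferentiableAt ℝ F x)
    (hhom : ∀ t : ℝ, F (t • x) = t ^ g * F x) :
    ⟪gradient F x, x⟫ = g * F x := by
  have hline : HasDerivAt (fun t : ℝ => t • x) x 1 := by
    simpa using (hasDerivAt_id (1 : ℝ)).smul_const x
  have hgrad : HasFDerivAt F (InnerProductSpace.toDual ℝ E (gradient F x)) ((1 : ℝ) • x) := by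
    simpa using hF.hasGradientAt.hasFDerivAt
  have hchain : HasDerivAt (fun t : ℝ => F (t • x)) ⟪gradient F x, x⟫ 1 := by
    simpa [Function.comp_def] using hgrad.comp_hasDerivAt (1 : ℝ) hline
  have hpow : HasDerivAt (fun t : ℝ => F (t • x)) (g * F x) 1 := by
    simpa [hhom] using (hasDerivAt_pow g (1 : ℝ)).mul_const (F x)
  exact hchain.unique hpow

/-- Münzner's equation `|grad^S V|² = g²(1 − V²)`: if `F` is differentiable,
homogeneous of degree `g`, and satisfies the first Cartan–Münzner equation
`‖∇F(x)‖² = g²‖x‖^{2g−2}`, then at every unit vector `x` the squared norm of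
the spherical gradient equals `g²·(1 − F(x)²)`. -/
theorem cartan_muenzner_spherical_gradient
    {E : Type*} [NormedAddCommGroup E] [InnerProductSpace ℝ E] [CompleteSpace E]
    (g : ℕ) (F : E → ℝ) (hF : Differentiable ℝ F)
    (hhom : ∀ (t : ℝ) (x : E), F (t • x) = t ^ g * F x)
    (hCM : ∀ x : E, ‖gradient F x‖ ^ 2 = (g : ℝ) ^ 2 * ‖x‖ ^ (2 * g - 2)) :
    ∀ x : E, ‖x‖ = 1 →
      ‖gradient F x - ⟪gradient F x, x⟫ • x‖ ^ 2 = (g : ℝ) ^ 2 * (1 - (F x) ^ 2) := by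
  intro x hx
  have hEuler := inner_gradient_self_of_homogeneous (hF x) fun t => hhom t x
  have hnorm : ‖gradient F x‖ ^ 2 = (g : ℝ) ^ 2 := by simpa [hx] using hCM x
  rw [norm_sub_sq_real, real_inner_smul_right, norm_smul, hx, hnorm, hEuler, mul_one,
    Real.norm_eq_abs, sq_abs]
  ring
end

section
/- Let F : EuclideanSpace ℝ 5 → ℝ be Cartan's cubic polynomial F(x, y, u, v, w) = x³ − 3xy² + (3/2)·x·(u² + v² − 2w²) + (3√3/2)·y·(u² − v²) + 3√3·uvw. Then F is harmonic, i.e., the sum of its five pure second partial derivatives vanishes identically, and its Euclidean gradient satisfies ‖∇F(p)‖² = 9·(x² + y² + u² + v² + w²)² for every p = (x, y, u, v, w) ∈ ℝ⁵. -/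
/-- The components of the gradient of Cartan's cubic. -/
noncomputable def cartanCubicGrad (p : EuclideanSpace ℝ (Fin 5)) : Fin 5 → ℝ :=
  ![3 * (p 0) ^ 2 - 3 * (p 1) ^ 2 + (3 / 2) * ((p 2) ^ 2 + (p 3) ^ 2 - 2 * (p 4) ^ 2),
    -6 * (p 0) * (p 1) + (3 * Real.sqrt 3 / 2) * ((p 2) ^ 2 - (p 3) ^ 2),
    3 * (p 0) * (p 2) + 3 * Real.sqrt 3 * (p 1) * (p 2) + 3 * Real.sqrt 3 * (p 3) * (p 4),
    3 * (p 0) * (p 3) - 3 * Real.sqrt 3 * (p 1) * (p 3) + 3 * Real.sqrt 3 * (p 2) * (p 4),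
    -6 * (p 0) * (p 4) + 3 * Real.sqrt 3 * (p 2) * (p 3)]

theorem EuclideanSpace.hasFDerivAt_apply {ι : Type*} [Fintype ι] (i : ι)
    (p : EuclideanSpace ℝ ι) :
    HasFDerivAt (fun q : EuclideanSpace ℝ ι => q i) (EuclideanSpace.proj i : _ →L[ℝ] ℝ) p :=
  (EuclideanSpace.proj i : EuclideanSpace ℝ ι →L[ℝ] ℝ).hasFDerivAt

theorem hasFDerivAt_cartanCubic (p : EuclideanSpace ℝ (Fin 5)) :
    HasFDerivAt (fun p : EuclideanSpace ℝ (Fin 5) => (p 0) ^ 3 - 3 * (p 0) * (p 1) ^ 2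
        + (3 / 2) * (p 0) * ((p 2) ^ 2 + (p 3) ^ 2 - 2 * (p 4) ^ 2)
        + (3 * Real.sqrt 3 / 2) * (p 1) * ((p 2) ^ 2 - (p 3) ^ 2)
        + 3 * Real.sqrt 3 * (p 2) * (p 3) * (p 4))
      (∑ i, cartanCubicGrad p i • (EuclideanSpace.proj i : EuclideanSpace ℝ (Fin 5) →L[ℝ] ℝ))
      p := by
  have h (i : Fin 5) := EuclideanSpace.hasFDerivAt_apply i p
  refine HasFDerivAt.congr_fderiv
    ((((((h 0).pow 3).sub (((h 0).const_mul 3).mul ((h 1).pow 2))).add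
      (((h 0).const_mul (3 / 2)).mul
        ((((h 2).pow 2).add ((h 3).pow 2)).sub (((h 4).pow 2).const_mul 2)))).add
      (((h 1).const_mul (3 * Real.sqrt 3 / 2)).mul (((h 2).pow 2).sub ((h 3).pow 2)))).add
      ((((h 2).const_mul (3 * Real.sqrt 3)).mul (h 3)).mul (h 4))) ?_
  ext v
  simp [Fin.sum_univ_five, cartanCubicGrad]
  ring

theorem gradient_apply_eq_fderiv_single {ι : Type*} [Fintype ι] [DecidableEq ι]
    (f : EuclideanSpace ℝ ι → ℝ) (p : EuclideanSpace ℝ ι) (i : ι) :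
    gradient f p i = fderiv ℝ f p (EuclideanSpace.single i 1) := by
  rw [← InnerProductSpace.toDual_symm_apply, EuclideanSpace.inner_single_right]
  simp [gradient]

theorem iteratedFDeriv_two_single_eq_fderiv {ι : Type*} [Fintype ι] [DecidableEq ι]
    {f : EuclideanSpace ℝ ι → ℝ} {p : EuclideanSpace ℝ ι}
    (hf : DifferentiableAt ℝ (fderiv ℝ f) p) (i : ι) :
    iteratedFDeriv ℝ 2 f p ![EuclideanSpace.single i 1, EuclideanSpace.single i 1]
      = fderiv ℝ (fun q => fderiv ℝ f q (EuclideanSpace.single i 1)) p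
          (EuclideanSpace.single i 1) := by
  rw [iteratedFDeriv_two_apply, fderiv_clm_apply hf (differentiableAt_const _)]
  simp

theorem sum_fderiv_cartanCubicGrad (p : EuclideanSpace ℝ (Fin 5)) :
    ∑ i, fderiv ℝ (fun q => cartanCubicGrad q i) p (EuclideanSpace.single i 1) = 0 := by
  have h (i : Fin 5) := EuclideanSpace.hasFDerivAt_apply i p
  have h0 := ((((h 0).pow 2).const_mul 3).sub (((h 1).pow 2).const_mul 3)).add
    (((((h 2).pow 2).add ((h 3).pow 2)).sub (((h 4).pow 2).const_mul 2)).const_mul (3 / 2))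
  have h1 := (((h 0).const_mul (-6)).mul (h 1)).add
    ((((h 2).pow 2).sub ((h 3).pow 2)).const_mul (3 * Real.sqrt 3 / 2))
  have h2 := ((((h 0).const_mul 3).mul (h 2)).add
    (((h 1).const_mul (3 * Real.sqrt 3)).mul (h 2))).add
    (((h 3).const_mul (3 * Real.sqrt 3)).mul (h 4))
  have h3 := ((((h 0).const_mul 3).mul (h 3)).sub
    (((h 1).const_mul (3 * Real.sqrt 3)).mul (h 3))).add
    (((h 2).const_mul (3 * Real.sqrt 3)).mul (h 4))
  have h4 := (((h 0).const_mul (-6)).mul (h 4)).add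
    (((h 2).const_mul (3 * Real.sqrt 3)).mul (h 3))
  have e0 : fderiv ℝ (fun q => cartanCubicGrad q 0) p = _ := h0.fderiv
  have e1 : fderiv ℝ (fun q => cartanCubicGrad q 1) p = _ := h1.fderiv
  have e2 : fderiv ℝ (fun q => cartanCubicGrad q 2) p = _ := h2.fderiv
  have e3 : fderiv ℝ (fun q => cartanCubicGrad q 3) p = _ := h3.fderiv
  have e4 : fderiv ℝ (fun q => cartanCubicGrad q 4) p = _ := h4.fderiv
  rw [Fin.sum_univ_five, e0, e1, e2, e3, e4]
  simp
  ring

/-- Cartan's cubic polynomial on `ℝ⁵` (the real case `F = ℝ`, `g = 3`, `m = 1`)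
is harmonic and satisfies the first Cartan–Münzner equation
`‖∇F‖² = 9·r⁴`. Coordinates: `x = p 0`, `y = p 1`, `u = p 2`, `v = p 3`,
`w = p 4`. -/
theorem cartan_cubic_real_case
    (F : EuclideanSpace ℝ (Fin 5) → ℝ)
    (hFdef : ∀ p : EuclideanSpace ℝ (Fin 5),
      F p = (p 0) ^ 3 - 3 * (p 0) * (p 1) ^ 2
        + (3 / 2) * (p 0) * ((p 2) ^ 2 + (p 3) ^ 2 - 2 * (p 4) ^ 2)
        + (3 * Real.sqrt 3 / 2) * (p 1) * ((p 2) ^ 2 - (p 3) ^ 2)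
        + 3 * Real.sqrt 3 * (p 2) * (p 3) * (p 4)) :
    (∀ p : EuclideanSpace ℝ (Fin 5),
      ∑ i : Fin 5, iteratedFDeriv ℝ 2 F p
        ![EuclideanSpace.single i 1, EuclideanSpace.single i 1] = 0) ∧
    (∀ p : EuclideanSpace ℝ (Fin 5),
      ‖gradient F p‖ ^ 2
        = 9 * ((p 0) ^ 2 + (p 1) ^ 2 + (p 2) ^ 2 + (p 3) ^ 2 + (p 4) ^ 2) ^ 2) := by
  have hF : F = _ := funext hFdef
  have hfderiv (p : EuclideanSpace ℝ (Fin 5)) := hF ▸ hasFDerivAt_cartanCubic p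
  have hgrad (p : EuclideanSpace ℝ (Fin 5)) (i : Fin 5) :
      fderiv ℝ F p (EuclideanSpace.single i 1) = cartanCubicGrad p i := by
    rw [(hfderiv p).fderiv]
    simp
  refine ⟨fun p => ?_, fun p => ?_⟩
  · rw [← sum_fderiv_cartanCubicGrad p]
    refine Finset.sum_congr rfl fun i _ => ?_
    rw [iteratedFDeriv_two_single_eq_fderiv]
    · simp only [hgrad]
    · exact (ContDiff.fderiv_right (m := 1) (n := 2) (by rw [hF]; fun_prop) (by norm_num)).differentiable
        (by norm_num) p
  · have h3 : Real.sqrt 3 ^ 2 = 3 := Real.sq_sqrt (by norm_num)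
    rw [EuclideanSpace.real_norm_sq_eq]
    simp only [gradient_apply_eq_fderiv_single, hgrad]
    simp only [Fin.sum_univ_five, cartanCubicGrad, Matrix.cons_val]
    grind
end

section
/- Let (u, v, w) and (u', v', w') be triples of real numbers with u² + v² + w² = 1 and u'² + v'² + w'² = 1. Suppose that √3·v·w = √3·v'·w', √3·w·u = √3·w'·u', √3·u·v = √3·u'·v', w² − (u² + v²)/2 = w'² − (u'² + v'²)/2, and (√3/2)·(v² − u²) = (√3/2)·(v'² − u'²). Then (u', v', w') = (u, v, w) or (u', v', w') = (−u, −v, −w). -/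
/-- Injectivity of Cartan's parametrization in the real case `F = ℝ`: two unit
vectors `(u, v, w)` and `(u', v', w')` of `ℝ³` with the same image under
`(u, v, w) ↦ (√3 vw, √3 wu, √3 uv, w² − (u² + v²)/2, (√3/2)(v² − u²))`
are equal or antipodal. -/
theorem cartan_parametrization_injective_real
    (u v w u' v' w' : ℝ)
    (h1 : u ^ 2 + v ^ 2 + w ^ 2 = 1)
    (h2 : u' ^ 2 + v' ^ 2 + w' ^ 2 = 1)
    (hX : Real.sqrt 3 * v * w = Real.sqrt 3 * v' * w')
    (hY : Real.sqrt 3 * w * u = Real.sqrt 3 * w' * u')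
    (hZ : Real.sqrt 3 * u * v = Real.sqrt 3 * u' * v')
    (hx : w ^ 2 - (u ^ 2 + v ^ 2) / 2 = w' ^ 2 - (u' ^ 2 + v' ^ 2) / 2)
    (hy : (Real.sqrt 3 / 2) * (v ^ 2 - u ^ 2) = (Real.sqrt 3 / 2) * (v' ^ 2 - u' ^ 2)) :
    (u' = u ∧ v' = v ∧ w' = w) ∨ (u' = -u ∧ v' = -v ∧ w' = -w) := by
  have h3 : Real.sqrt 3 ≠ 0 := by positivity
  have hvw : v * w = v' * w' := mul_left_cancel₀ h3 (by linarith)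
  have hwu : w * u = w' * u' := mul_left_cancel₀ h3 (by linarith)
  have huv : u * v = u' * v' := mul_left_cancel₀ h3 (by linarith)
  have hd : v ^ 2 - u ^ 2 = v' ^ 2 - u' ^ 2 := mul_left_cancel₀ h3 (by linarith)
  have hww : w ^ 2 = w' ^ 2 := by linarith
  have hvv : v ^ 2 = v' ^ 2 := by linarith
  have huu : u ^ 2 = u' ^ 2 := by linarith
  -- The rank-one matrices `x xᵀ` and `x' x'ᵀ` agree, so `x' = ⟪x, x'⟫ x`.
  obtain ⟨s, hs⟩ : ∃ s, s = u * u' + v * v' + w * w' := ⟨_, rfl⟩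
  have hu : u' = s * u := by
    linear_combination -u' * h2 - u * hs - u' * huu - v' * huv - w' * hwu
  have hv : v' = s * v := by
    linear_combination -v' * h2 - v * hs - u' * huv - v' * hvv - w' * hvw
  have hw : w' = s * w := by
    linear_combination -w' * h2 - w * hs - u' * hwu - v' * hvw - w' * hww
  have hs2 : s ^ 2 = 1 := by
    rw [hu, hv, hw] at h2
    linear_combination h2 - s ^ 2 * h1
  rcases eq_or_eq_neg_of_sq_eq_sq s 1 (by rw [hs2, one_pow]) with h | h <;> rw [h] at hu hv hw
  · exact Or.inl ⟨by linarith, by linarith, by linarith⟩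
  · exact Or.inr ⟨by linarith, by linarith, by linarith⟩
end

section
/- Let u, v, w be quaternions with ‖u‖² + ‖v‖² + ‖w‖² = 1, and define X = √3·v·star(w), Y = √3·w·star(u), Z = √3·u·star(v), x = ‖w‖² − (‖u‖² + ‖v‖²)/2, y = (√3/2)·(‖v‖² − ‖u‖²). Then x² + y² + ‖X‖² + ‖Y‖² + ‖Z‖² = 1 and F(x, y, X, Y, Z) = 1, where F is Cartan's cubic F(x, y, X, Y, Z) = x³ − 3xy² + (3/2)·x·(‖X‖² + ‖Y‖² − 2‖Z‖²) + (3√3/2)·y·(‖X‖² − ‖Y‖²) + (3√3/2)·(X·Y·Z + star(X·Y·Z)).re, with star denoting quaternionic conjugation and (·).re the real part of a quaternion. -/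
/-- The cyclic product `(v w̄)(w ū)(u v̄)` of quaternions is the real number `‖u‖² ‖v‖² ‖w‖²`. -/
theorem Quaternion.cyclic_mul_star (u v w : Quaternion ℝ) :
    v * star w * (w * star u) * (u * star v) =
      ((‖u‖ ^ 2 * ‖v‖ ^ 2 * ‖w‖ ^ 2 : ℝ) : Quaternion ℝ) := by
  have hassoc : v * star w * (w * star u) * (u * star v) =
      v * ((star w * w) * (star u * u)) * star v := by
    simp only [mul_assoc]
  rw [hassoc, Quaternion.star_mul_self, Quaternion.star_mul_self, ← Quaternion.coe_mul,
    ← Quaternion.coe_commutes, mul_assoc, Quaternion.self_mul_star, ← Quaternion.coe_mul]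
  simp only [Quaternion.normSq_eq_norm_mul_self]
  congr 1
  ring

/-- Cartan's parametrization of the focal submanifold in the quaternionic case
`F = ℍ`: for `‖u‖² + ‖v‖² + ‖w‖² = 1` in `ℍ³`, the point `(x, y, X, Y, Z)` with
`X = √3 v (star w)`, `Y = √3 w (star u)`, `Z = √3 u (star v)`,
`x = ‖w‖² − (‖u‖² + ‖v‖²)/2`, `y = (√3/2)(‖v‖² − ‖u‖²)` lies on the unit
sphere `S¹³ ⊂ ℝ² × ℍ³` and on the level set `F = 1` of Cartan's cubic. -/
theorem cartan_focal_parametrization_quaternion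
    (u v w X Y Z : Quaternion ℝ) (x y : ℝ)
    (huvw : ‖u‖ ^ 2 + ‖v‖ ^ 2 + ‖w‖ ^ 2 = 1)
    (hX : X = Real.sqrt 3 • (v * star w))
    (hY : Y = Real.sqrt 3 • (w * star u))
    (hZ : Z = Real.sqrt 3 • (u * star v))
    (hx : x = ‖w‖ ^ 2 - (‖u‖ ^ 2 + ‖v‖ ^ 2) / 2)
    (hy : y = (Real.sqrt 3 / 2) * (‖v‖ ^ 2 - ‖u‖ ^ 2)) :
    x ^ 2 + y ^ 2 + ‖X‖ ^ 2 + ‖Y‖ ^ 2 + ‖Z‖ ^ 2 = 1 ∧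
    x ^ 3 - 3 * x * y ^ 2 + (3 / 2) * x * (‖X‖ ^ 2 + ‖Y‖ ^ 2 - 2 * ‖Z‖ ^ 2)
      + (3 * Real.sqrt 3 / 2) * y * (‖X‖ ^ 2 - ‖Y‖ ^ 2)
      + (3 * Real.sqrt 3 / 2) * (X * Y * Z + star (X * Y * Z)).re = 1 := by
  have h3 : Real.sqrt 3 ^ 2 = 3 := Real.sq_sqrt (by norm_num)
  have norm_sq_smul (p q : Quaternion ℝ) :
      ‖Real.sqrt 3 • (p * star q)‖ ^ 2 = 3 * (‖p‖ ^ 2 * ‖q‖ ^ 2) := by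
    rw [norm_smul, norm_mul, norm_star, Real.norm_of_nonneg (Real.sqrt_nonneg 3), mul_pow, h3,
      mul_pow]
  have hXYZ : (X * Y * Z + star (X * Y * Z)).re =
      6 * Real.sqrt 3 * (‖u‖ ^ 2 * ‖v‖ ^ 2 * ‖w‖ ^ 2) := by
    have hprod : X * Y * Z = (Real.sqrt 3 ^ 2 * Real.sqrt 3) •
        ((‖u‖ ^ 2 * ‖v‖ ^ 2 * ‖w‖ ^ 2 : ℝ) : Quaternion ℝ) := by
      rw [hX, hY, hZ, ← Quaternion.cyclic_mul_star]
      simp only [smul_mul_assoc, mul_smul_comm, smul_smul]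
      congr 1
      ring
    rw [Quaternion.re_add, Quaternion.re_star, hprod, Quaternion.re_smul, Quaternion.re_coe, h3,
      smul_eq_mul]
    ring
  rw [hXYZ, hX, hY, hZ, norm_sq_smul, norm_sq_smul, norm_sq_smul, hx, hy]
  have hw : ‖w‖ ^ 2 = 1 - ‖u‖ ^ 2 - ‖v‖ ^ 2 := by linarith
  rw [hw]
  generalize ‖u‖ ^ 2 = a
  generalize ‖v‖ ^ 2 = b
  constructor
  · ring_nf
    rw [h3]
    ring
  · ring_nf
    rw [h3]
    ring
end
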